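/- Let n ≥ 2 be an integer and let (i,i') be a minimal regularity element for n with i ≤ i' and i(i'+2) > n. Then Δ²H_n(i−1, i'+1) = n − ii' − 2i, which is strictly negative, and Δ²H_n(i, i'+1) = −3n + 3ii' + 4i + i'. -/

import Mathlib

/-- The generic Hilbert function of `n` points in sufficiently general position
in `ℙ¹ × ℙ¹`. -/
def Hgen (n i i' : ℤ) : ℤ :=
  if 0 ≤ i ∧ 0 ≤ i' then min n ((i + 1) * (i' + 1)) else 0

/-- The second difference function `Δ²H_n`. -/
def Delta2H (n i i' : ℤ) : ℤ :=
  ∑ a ∈ Finset.range 3, ∑ b ∈ Finset.range 3,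
    (-1 : ℤ) ^ (a + b) * (Nat.choose 2 a : ℤ) * (Nat.choose 2 b : ℤ) *
      Hgen n (i - (a : ℤ)) (i' - (b : ℤ))

/-- `(i, i')` is a minimal element of the multigraded regularity of the coordinate
ring of `n` points in sufficiently general position in `ℙ¹ × ℙ¹`. -/
def MinRegElem (n i i' : ℤ) : Prop :=
  0 ≤ i ∧ 0 ≤ i' ∧ (i + 1) * (i' + 1) ≥ n ∧ i * (i' + 1) < n ∧ (i + 1) * i' < n

theorem Hgen_big (n x y : ℤ) (hx : 0 ≤ x) (hy : 0 ≤ y) (h : n ≤ (x + 1) * (y + 1)) :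
    Hgen n x y = n := by
  unfold Hgen
  rw [if_pos ⟨hx, hy⟩, min_eq_left h]

theorem Hgen_small (n x y : ℤ) (hx : -1 ≤ x) (hy : 0 ≤ y) (h : (x + 1) * (y + 1) ≤ n) :
    Hgen n x y = (x + 1) * (y + 1) := by
  unfold Hgen
  by_cases h0 : 0 ≤ x
  · rw [if_pos ⟨h0, hy⟩, min_eq_right h]
  · have hx1 : x = -1 := by omega
    subst hx1
    simp

theorem stmt_15 (n i i' : ℤ) (hn : 2 ≤ n) (h : MinRegElem n i i')
    (hii' : i ≤ i') (h1 : i * (i' + 2) > n) :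
    Delta2H n (i - 1) (i' + 1) = n - i * i' - 2 * i ∧
      n - i * i' - 2 * i < 0 ∧
      Delta2H n i (i' + 1) = -3 * n + 3 * i * i' + 4 * i + i' := by
  obtain ⟨hi, hi', ha, hb, hc⟩ := h
  have hi2 : 2 ≤ i := by
    by_contra hlt
    have hcases : i = 0 ∨ i = 1 := by omega
    rcases hcases with rfl | rfl <;> omega
  have e1 : Hgen n i (i' + 1) = n := Hgen_big _ _ _ (by omega) (by omega) (by nlinarith)
  have e2 : Hgen n i i' = n := Hgen_big _ _ _ (by omega) (by omega) (by nlinarith)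
  have e3 : Hgen n i (i' - 1) = _ := Hgen_small _ _ _ (by omega) (by omega) (by nlinarith)
  have f1 : Hgen n (i - 1) (i' + 1) = n := Hgen_big _ _ _ (by omega) (by omega) (by nlinarith)
  have f2 : Hgen n (i - 1) i' = _ := Hgen_small _ _ _ (by omega) (by omega) (by nlinarith)
  have f3 : Hgen n (i - 1) (i' - 1) = _ := Hgen_small _ _ _ (by omega) (by omega) (by nlinarith)
  have g1 : Hgen n (i - 2) (i' + 1) = _ := Hgen_small _ _ _ (by omega) (by omega) (by nlinarith)
  have g2 : Hgen n (i - 2) i' = _ := Hgen_small _ _ _ (by omega) (by omega) (by nlinarith)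
  have g3 : Hgen n (i - 2) (i' - 1) = _ := Hgen_small _ _ _ (by omega) (by omega) (by nlinarith)
  have k1 : Hgen n (i - 3) (i' + 1) = _ := Hgen_small _ _ _ (by omega) (by omega) (by nlinarith)
  have k2 : Hgen n (i - 3) i' = _ := Hgen_small _ _ _ (by omega) (by omega) (by nlinarith)
  have k3 : Hgen n (i - 3) (i' - 1) = _ := Hgen_small _ _ _ (by omega) (by omega) (by nlinarith)
  have r1 : i - 1 - 1 = i - 2 := by ring
  have r2 : i - 1 - 2 = i - 3 := by ring
  have r3 : i' + 1 - 1 = i' := by ring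
  have r4 : i' + 1 - 2 = i' - 1 := by ring
  refine ⟨?_, by nlinarith, ?_⟩
  · simp only [Delta2H, Finset.sum_range_succ, Finset.sum_range_zero, Nat.cast_zero, Nat.cast_one,
      Nat.cast_ofNat, sub_zero, r1, r2, r3, r4, f1, f2, f3, g1, g2, g3, k1, k2, k3]
    norm_num
    ring
  · simp only [Delta2H, Finset.sum_range_succ, Finset.sum_range_zero, Nat.cast_zero, Nat.cast_one,
      Nat.cast_ofNat, sub_zero, r3, r4, e1, e2, e3, f1, f2, f3, g1, g2, g3]
    norm_num
    ring
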